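/- Let R be a NAND-free k-ary Boolean relation. If F is a flip sequence valid at s ∈ R, then there exists a valid canonical flip sequence F' equivalent to F such that C(F') ⊆ C(F) and, for any two flips f_1, f_2 ∈ F' of the same sign, if f_1 appears before f_2 in F' then f_1 appears before f_2 in F (i.e., the relative order among flips of the same sign is preserved). -/

import Mathlib

def IsRestriction {k k' : ℕ} (R : Set (Fin k → Bool)) (R' : Set (Fin k' → Bool)) : Prop :=
  k' ≤ k ∧ ∃ X : Fin k → (Fin k' ⊕ Bool),
    ∀ r : Fin k' → Bool, r ∈ R' ↔ (fun i => Sum.elim r id (X i)) ∈ R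

/-- The NAND relation `{01, 10, 00}`. -/
def nandRel : Set (Fin 2 → Bool) := {r | ¬(r 0 = true ∧ r 1 = true)}

/-- The OR relation `{01, 10, 11}`. -/
def orRel : Set (Fin 2 → Bool) := {r | r 0 = true ∨ r 1 = true}

/-- The dual-Horn-clause relation `{0,1}^3 \ {100}`. -/
def dualHornRel : Set (Fin 3 → Bool) := {r | ¬(r 0 = true ∧ r 1 = false ∧ r 2 = false)}

/-- `R` is NAND-free if no restriction of `R` equals the NAND relation `{01,10,00}`. -/
def NANDFree {k : ℕ} (R : Set (Fin k → Bool)) : Prop := ¬ IsRestriction R nandRel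

/-- `R` is OR-free if no restriction of `R` equals the OR relation `{01,10,11}`. -/
def ORFree {k : ℕ} (R : Set (Fin k → Bool)) : Prop := ¬ IsRestriction R orRel

/-- `R` is dual-Horn-free if no restriction of `R` equals `{0,1}^3 \ {100}`. -/
def DualHornFree {k : ℕ} (R : Set (Fin k → Bool)) : Prop := ¬ IsRestriction R dualHornRel

/-- A flip is a variable together with the value it flips *to*:
`(i, true)` is the positive flip `xᵢ⁺` (0→1), `(i, false)` the negative flip `xᵢ⁻` (1→0). -/
abbrev Flip (α : Type) := α × Bool

/-- Apply a flip to an assignment. -/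
def applyFlip {α : Type} [DecidableEq α] (a : α → Bool) (f : Flip α) : α → Bool :=
  Function.update a f.1 f.2

/-- Apply a flip sequence (left to right) to an assignment; `applySeq s F` is `F(s)`. -/
def applySeq {α : Type} [DecidableEq α] (s : α → Bool) (F : List (Flip α)) : α → Bool :=
  F.foldl applyFlip s

/-- `ValidSeq R s F`: the flip sequence `F` is valid at `s` with respect to `R`, i.e.
each flip in turn is applicable and every intermediate assignment (including `s` and
the final one) lies in `R`. -/
def ValidSeq {α : Type} [DecidableEq α] (R : Set (α → Bool)) :
    (α → Bool) → List (Flip α) → Prop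
  | s, [] => s ∈ R
  | s, f :: F => s ∈ R ∧ s f.1 = !f.2 ∧ ValidSeq R (applyFlip s f) F

/-- A flip sequence is *canonical* if all its positive flips occur before all its
negative flips. -/
def IsCanonical {α : Type} (F : List (Flip α)) : Prop :=
  ∃ P N : List (Flip α), F = P ++ N ∧ (∀ f ∈ P, f.2 = true) ∧ (∀ f ∈ N, f.2 = false)

theorem ValidSeq.mem {α : Type} [DecidableEq α] {R : Set (α → Bool)} {s : α → Bool}
    {F : List (Flip α)} (h : ValidSeq R s F) : s ∈ R := by
  cases F with
  | nil => exact h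
  | cons f F => exact h.1

/-- In a NAND-free relation, if two distinct coordinates can be set to `10`, `00` and `01`,
then they can also both be set to `1`. -/
theorem NANDFree.update_update_mem {k : ℕ} {R : Set (Fin k → Bool)} (hR : NANDFree R)
    {s : Fin k → Bool} {i j : Fin k} (hij : i ≠ j) (hi : s i = true) (hj : s j = false)
    (h10 : s ∈ R) (h00 : Function.update s i false ∈ R)
    (h01 : Function.update (Function.update s i false) j true ∈ R) :
    Function.update s j true ∈ R := by
  by_contra h11
  refine hR ⟨?_, fun l => if l = i then .inl 0 else if l = j then .inl 1 else .inr (s l), ?_⟩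
  · have := Fin.val_ne_of_ne hij
    omega
  · intro r
    have key : (fun l => Sum.elim r id
        (if l = i then .inl 0 else if l = j then .inl 1 else .inr (s l) : Fin 2 ⊕ Bool)) =
        Function.update (Function.update s i (r 0)) j (r 1) := by
      funext l
      by_cases hli : l = i
      · subst hli
        simp [hij]
      · by_cases hlj : l = j
        · subst hlj
          simp [hli]
        · simp [hli, hlj]
    have hsi : Function.update s i true = s := by rw [← hi, Function.update_eq_self]
    have hsj : Function.update (Function.update s i false) j false =
        Function.update s i false := by
      rw [Function.update_eq_self_iff, Function.update_of_ne hij.symm, hj]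
    have hsj' : Function.update s j false = s := by rw [← hj, Function.update_eq_self]
    rw [key]
    change ¬(r 0 = true ∧ r 1 = true) ↔ _
    cases h0 : r 0 <;> cases h1 : r 1 <;> simp [hsi, hsj, hsj', h10, h00, h01, h11]

/-- A negative flip can be moved past a block of positive flips. -/
theorem NANDFree.exists_validSeq_of_neg_cons {k : ℕ} {R : Set (Fin k → Bool)} (hR : NANDFree R)
    (i : Fin k) (N P : List (Flip (Fin k))) (hP : ∀ f ∈ P, f.2 = true) (s : Fin k → Bool)
    (h : ValidSeq R s ((i, false) :: (P ++ N))) :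
    ∃ P' N' : List (Flip (Fin k)), ValidSeq R s (P' ++ N') ∧
      applySeq s (P' ++ N') = applySeq s ((i, false) :: (P ++ N)) ∧
      P'.Sublist P ∧ N'.Sublist ((i, false) :: N) := by
  induction P generalizing s with
  | nil => exact ⟨[], (i, false) :: N, h, rfl, List.Sublist.refl _, List.Sublist.refl _⟩
  | cons p P ih =>
    obtain ⟨j, b⟩ := p
    obtain rfl : b = true := hP (j, b) List.mem_cons_self
    obtain ⟨h10, hi, h00, hj, hrest⟩ := h
    by_cases hij : i = j
    · subst hij
      have hs : applyFlip (applyFlip s (i, false)) (i, true) = s := by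
        have hi' : s i = true := hi
        simp [applyFlip, ← hi']
      refine ⟨P, N, hs ▸ hrest, ?_, List.sublist_cons_self _ _, List.sublist_cons_self _ _⟩
      change _ = applySeq (applyFlip (applyFlip s (i, false)) (i, true)) (P ++ N)
      rw [hs]
    · have hcomm : applyFlip (applyFlip s (i, false)) (j, true) =
          applyFlip (applyFlip s (j, true)) (i, false) :=
        Function.update_comm hij _ _ _
      have hi' : s i = true := hi
      have hj' : s j = false := by simpa [applyFlip, Ne.symm hij] using hj
      have h11 : applyFlip s (j, true) ∈ R :=
        hR.update_update_mem hij hi' hj' h10 h00 hrest.mem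
      have hi'' : applyFlip s (j, true) i = true := by simpa [applyFlip, hij] using hi'
      obtain ⟨P', N', hv, he, hPs, hNs⟩ :=
        ih (fun f hf => hP f (List.mem_cons_of_mem _ hf)) (applyFlip s (j, true))
          ⟨h11, hi'', hcomm ▸ hrest⟩
      refine ⟨(j, true) :: P', N', ⟨h10, hj', hv⟩, he.trans ?_, hPs.cons_cons _, hNs⟩
      change applySeq (applyFlip (applyFlip s (j, true)) (i, false)) (P ++ N) =
        applySeq (applyFlip (applyFlip s (i, false)) (j, true)) (P ++ N)
      rw [hcomm]

/-- Every valid flip sequence in a NAND-free relation is equivalent to a valid one made of a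
sublist of its positive flips followed by a sublist of its negative flips. -/
theorem NANDFree.exists_validSeq_append {k : ℕ} {R : Set (Fin k → Bool)} (hR : NANDFree R)
    (F : List (Flip (Fin k))) (s : Fin k → Bool) (hF : ValidSeq R s F) :
    ∃ P N : List (Flip (Fin k)), ValidSeq R s (P ++ N) ∧
      applySeq s (P ++ N) = applySeq s F ∧
      P.Sublist (F.filter (fun f => f.2)) ∧ N.Sublist (F.filter (fun f => !f.2)) := by
  induction F generalizing s with
  | nil => exact ⟨[], [], hF, rfl, List.nil_sublist _, List.nil_sublist _⟩
  | cons f F ih =>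
    obtain ⟨P, N, hv, he, hP, hN⟩ := ih _ hF.2.2
    obtain ⟨i, _ | _⟩ := f
    · obtain ⟨P', N', hv', he', hP', hN'⟩ := hR.exists_validSeq_of_neg_cons i N P
        (fun f hf => (List.mem_filter.1 (hP.subset hf)).2) s ⟨hF.1, hF.2.1, hv⟩
      exact ⟨P', N', hv', he'.trans he, hP'.trans hP, hN'.trans (hN.cons_cons _)⟩
    · exact ⟨(i, true) :: P, N, ⟨hF.1, hF.2.1, hv⟩, he, hP.cons_cons _, hN⟩

/-- Lemma 2: for `R` a NAND-free relation and `F` a valid flip sequence at `s ∈ R`,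
there is a valid canonical flip sequence `F'` equivalent to `F` with `C(F') ⊆ C(F)`
that preserves the relative order among flips of the same sign (the positive flips of
`F'` form a sublist of those of `F`, and likewise for the negative flips). -/
theorem exists_canonical_equiv {k : ℕ} (R : Set (Fin k → Bool)) (hR : NANDFree R)
    (s : Fin k → Bool) (hs : s ∈ R) (F : List (Flip (Fin k)))
    (hF : ValidSeq R s F) :
    ∃ F' : List (Flip (Fin k)),
      ValidSeq R s F' ∧ applySeq s F' = applySeq s F ∧ IsCanonical F' ∧
      (∀ f ∈ F', f ∈ F) ∧
      List.Sublist (F'.filter (fun f => f.2)) (F.filter (fun f => f.2)) ∧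
      List.Sublist (F'.filter (fun f => !f.2)) (F.filter (fun f => !f.2)) := by
  obtain ⟨P, N, hv, he, hP, hN⟩ := hR.exists_validSeq_append F s hF
  have hP' : ∀ f ∈ P, f.2 = true := fun f hf => (List.mem_filter.1 (hP.subset hf)).2
  have hN' : ∀ f ∈ N, f.2 = false := fun f hf => by
    simpa using (List.mem_filter.1 (hN.subset hf)).2
  refine ⟨P ++ N, hv, he, ⟨P, N, rfl, hP', hN'⟩, fun f hf => ?_, ?_, ?_⟩
  · rcases List.mem_append.1 hf with hf | hf
    · exact (List.mem_filter.1 (hP.subset hf)).1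
    · exact (List.mem_filter.1 (hN.subset hf)).1
  · rw [List.filter_append, List.filter_eq_self.2 hP',
      List.filter_eq_nil_iff.2 (fun f hf => by simp [hN' f hf]), List.append_nil]
    exact hP
  · rw [List.filter_append, List.filter_eq_nil_iff.2 (fun f hf => by simp [hP' f hf]),
      List.filter_eq_self.2 (fun f hf => by simp [hN' f hf]), List.nil_append]
    exact hN
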